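/- Let A₁,…,A_m ∈ Sym(n), b ∈ ℝ^m, μ > 0, ε > 0, and let D ∈ Sym(n) be a cost matrix satisfying D ⪰ (λ/2)·I for some λ > 0. Define 𝒜(X)_i = ⟨A_i,X⟩, r(U) = 𝒜(UUᵀ) − b, and L(U) = ⟨D, UUᵀ⟩ + μ‖r(U)‖₂². If U ∈ ℝ^{n×k} is an ε-FOSP of L, then ‖U‖_F² ≤ max{ (2ε/λ)², (2μ/λ)‖b‖₂² }, and consequently ‖r(U)‖₂ ≤ ‖𝒜‖·max{ (2ε/λ)², (2μ/λ)‖b‖₂² } + ‖b‖₂. -/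

import Mathlib

open Matrix

attribute [local instance] Matrix.normedAddCommGroup Matrix.normedSpace

/-- Trace inner product `⟨A, B⟩ = Tr(Aᵀ B)` on square matrices. -/
noncomputable def mip {n : ℕ} (A B : Matrix (Fin n) (Fin n) ℝ) : ℝ := (Aᵀ * B).trace

/-- Frobenius inner product on rectangular matrices. -/
noncomputable def mipr {n k : ℕ} (A B : Matrix (Fin n) (Fin k) ℝ) : ℝ :=
  ∑ i, ∑ j, A i j * B i j

/-- Euclidean norm of a vector. -/
noncomputable def vnorm {k : ℕ} (z : Fin k → ℝ) : ℝ := Real.sqrt (∑ i, z i ^ 2)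

/-- Frobenius norm of a matrix. -/
noncomputable def fnorm {n k : ℕ} (A : Matrix (Fin n) (Fin k) ℝ) : ℝ :=
  Real.sqrt (∑ i, ∑ j, A i j ^ 2)

/-- Operator norm `‖𝒜‖ = max{‖𝒜(Y)‖₂ : Y ∈ Sym(n), ‖Y‖_F ≤ 1}` of `𝒜(X)ᵢ = ⟨Aᵢ, X⟩`. -/
noncomputable def opA {n m : ℕ} (A : Fin m → Matrix (Fin n) (Fin n) ℝ) : ℝ :=
  sSup {t | ∃ Y : Matrix (Fin n) (Fin n) ℝ, Y.IsSymm ∧ fnorm Y ≤ 1 ∧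
    t = vnorm (fun i => mip (A i) Y)}

theorem vnorm_nonneg {k : ℕ} (z : Fin k → ℝ) : 0 ≤ vnorm z := Real.sqrt_nonneg _

theorem vnorm_sq {k : ℕ} (z : Fin k → ℝ) : vnorm z ^ 2 = ∑ i, z i ^ 2 :=
  Real.sq_sqrt (by positivity)

theorem vnorm_eq_norm_toLp {k : ℕ} (z : Fin k → ℝ) : vnorm z = ‖WithLp.toLp 2 z‖ := by
  simp [vnorm, EuclideanSpace.norm_eq]

theorem vnorm_sub_le {k : ℕ} (z w : Fin k → ℝ) :
    vnorm (fun i => z i - w i) ≤ vnorm z + vnorm w := by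
  simp only [vnorm_eq_norm_toLp]
  exact norm_sub_le (WithLp.toLp 2 z) (WithLp.toLp 2 w)

theorem vnorm_smul {k : ℕ} (c : ℝ) (z : Fin k → ℝ) :
    vnorm (fun i => c * z i) = |c| * vnorm z := by
  simp only [vnorm_eq_norm_toLp]
  exact norm_smul c (WithLp.toLp 2 z)

theorem fnorm_nonneg {n k : ℕ} (A : Matrix (Fin n) (Fin k) ℝ) : 0 ≤ fnorm A :=
  Real.sqrt_nonneg _

theorem fnorm_sq {n k : ℕ} (A : Matrix (Fin n) (Fin k) ℝ) :
    fnorm A ^ 2 = ∑ i, ∑ j, A i j ^ 2 :=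
  Real.sq_sqrt (by positivity)

theorem fnorm_smul {n k : ℕ} (c : ℝ) (A : Matrix (Fin n) (Fin k) ℝ) :
    fnorm (c • A) = |c| * fnorm A := by
  simp only [fnorm, Matrix.smul_apply, smul_eq_mul, mul_pow, ← Finset.mul_sum]
  rw [Real.sqrt_mul (sq_nonneg c), Real.sqrt_sq_eq_abs]

/-- Cauchy–Schwarz for the Frobenius inner product. -/
theorem mipr_le_fnorm_mul_fnorm {n k : ℕ} (A B : Matrix (Fin n) (Fin k) ℝ) :
    mipr A B ≤ fnorm A * fnorm B := by
  simp only [mipr, fnorm, ← Fintype.sum_prod_type']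
  exact Real.sum_mul_le_sqrt_mul_sqrt _ _ _

theorem mipr_sq_le {n k : ℕ} (A B : Matrix (Fin n) (Fin k) ℝ) :
    mipr A B ^ 2 ≤ fnorm A ^ 2 * fnorm B ^ 2 := by
  simp only [fnorm_sq, mipr, ← Fintype.sum_prod_type']
  exact Finset.sum_mul_sq_le_sq_mul_sq _ _ _

theorem mip_eq_mipr {n : ℕ} (A B : Matrix (Fin n) (Fin n) ℝ) : mip A B = mipr A B := by
  simp only [mip, mipr, Matrix.trace, Matrix.diag, Matrix.mul_apply, Matrix.transpose_apply]
  exact Finset.sum_comm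

theorem mip_smul_right {n : ℕ} (A B : Matrix (Fin n) (Fin n) ℝ) (c : ℝ) :
    mip A (c • B) = c * mip A B := by
  simp [mip]

theorem fnorm_mul_transpose_self_le {n k : ℕ} (U : Matrix (Fin n) (Fin k) ℝ) :
    fnorm (U * Uᵀ) ≤ fnorm U ^ 2 := by
  refine Real.sqrt_le_iff.2 ⟨sq_nonneg _, ?_⟩
  calc ∑ i, ∑ l, (U * Uᵀ) i l ^ 2
      ≤ ∑ i, ∑ l, (∑ j, U i j ^ 2) * ∑ j, U l j ^ 2 := by
        gcongr with i _ l _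
        simp only [Matrix.mul_apply, Matrix.transpose_apply]
        exact Finset.sum_mul_sq_le_sq_mul_sq _ _ _
    _ = (fnorm U ^ 2) ^ 2 := by
        rw [fnorm_sq, sq, Finset.sum_mul_sum]

theorem bddAbove_opA {n m : ℕ} (A : Fin m → Matrix (Fin n) (Fin n) ℝ) :
    BddAbove {t | ∃ Y : Matrix (Fin n) (Fin n) ℝ, Y.IsSymm ∧ fnorm Y ≤ 1 ∧
      t = vnorm (fun i => mip (A i) Y)} := by
  refine ⟨Real.sqrt (∑ i, fnorm (A i) ^ 2), ?_⟩
  rintro t ⟨Y, -, hY, rfl⟩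
  refine Real.sqrt_le_sqrt (Finset.sum_le_sum fun i _ => ?_)
  simp only [mip_eq_mipr]
  exact (mipr_sq_le _ _).trans <| mul_le_of_le_one_right (sq_nonneg _) <|
    pow_le_one₀ (fnorm_nonneg Y) hY

theorem opA_nonneg {n m : ℕ} (A : Fin m → Matrix (Fin n) (Fin n) ℝ) : 0 ≤ opA A :=
  Real.sSup_nonneg (by rintro t ⟨Y, -, -, rfl⟩; exact vnorm_nonneg _)

theorem vnorm_mip_le_opA_mul_fnorm {n m : ℕ} (A : Fin m → Matrix (Fin n) (Fin n) ℝ)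
    {Y : Matrix (Fin n) (Fin n) ℝ} (hY : Y.IsSymm) :
    vnorm (fun i => mip (A i) Y) ≤ opA A * fnorm Y := by
  rcases (fnorm_nonneg Y).eq_or_lt with h | h
  · have hsq : vnorm (fun i => mip (A i) Y) ^ 2 ≤ 0 := by
      rw [vnorm_sq]
      refine Finset.sum_nonpos fun i _ => ?_
      simpa [mip_eq_mipr, ← h] using mipr_sq_le (A i) Y
    rw [← h, mul_zero]
    exact (pow_eq_zero_iff two_ne_zero).1 (le_antisymm hsq (sq_nonneg _)) |>.le
  · have hmem : vnorm (fun i => mip (A i) ((fnorm Y)⁻¹ • Y)) ≤ opA A := by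
      refine le_csSup (bddAbove_opA A) ⟨(fnorm Y)⁻¹ • Y, hY.smul _, ?_, rfl⟩
      rw [fnorm_smul, abs_of_pos (inv_pos.2 h), inv_mul_cancel₀ h.ne']
    simp only [mip_smul_right] at hmem
    rwa [vnorm_smul, abs_of_pos (inv_pos.2 h), inv_mul_le_iff₀ h, mul_comm] at hmem

theorem mul_fnorm_sq_le_mip {n k : ℕ} {D : Matrix (Fin n) (Fin n) ℝ} {c : ℝ}
    (hD : (D - c • (1 : Matrix (Fin n) (Fin n) ℝ)).PosSemidef)
    (U : Matrix (Fin n) (Fin k) ℝ) : c * fnorm U ^ 2 ≤ mip D (U * Uᵀ) := by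
  have hnonneg := (hD.conjTranspose_mul_mul_same U).trace_nonneg
  have hsymm : Dᵀ = D := by
    have h := hD.isHermitian.eq
    simpa [Matrix.conjTranspose_eq_transpose_of_trivial] using h
  have hfnorm : fnorm U ^ 2 = (Uᵀ * U).trace := by
    rw [fnorm_sq]
    simp only [Matrix.trace, Matrix.diag, Matrix.mul_apply, Matrix.transpose_apply, sq]
    exact Finset.sum_comm
  have hmip : mip D (U * Uᵀ) = (Uᵀ * D * U).trace := by
    rw [mip, hsymm, ← Matrix.mul_assoc, Matrix.trace_mul_comm, Matrix.mul_assoc]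
  rw [Matrix.conjTranspose_eq_transpose_of_trivial, Matrix.mul_sub, Matrix.sub_mul,
    Matrix.trace_sub, Matrix.mul_smul, Matrix.smul_mul, Matrix.trace_smul, Matrix.mul_one,
    smul_eq_mul] at hnonneg
  rw [hmip, hfnorm]
  linarith

theorem differentiable_mip_mul_transpose_self {n : ℕ} (k : ℕ) (B : Matrix (Fin n) (Fin n) ℝ) :
    Differentiable ℝ (fun W : Matrix (Fin n) (Fin k) ℝ => mip B (W * Wᵀ)) := by
  have hentry (i : Fin n) (j : Fin k) :
      Differentiable ℝ (fun W : Matrix (Fin n) (Fin k) ℝ => W i j) :=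
    (LinearMap.toContinuousLinearMap (Matrix.entryLinearMap ℝ ℝ i j)).differentiable
  simp only [mip_eq_mipr, mipr, Matrix.mul_apply, Matrix.transpose_apply]
  fun_prop

theorem fderiv_apply_self {E : Type*} [NormedAddCommGroup E] [NormedSpace ℝ E] {f : E → ℝ}
    {x : E} {d : ℝ} (hf : DifferentiableAt ℝ f x)
    (h : HasDerivAt (fun t : ℝ => f (t • x)) d 1) : fderiv ℝ f x x = d := by
  have hray : HasDerivAt (fun t : ℝ => t • x) x 1 := by
    simpa using (hasDerivAt_id (1 : ℝ)).smul_const x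
  exact (hf.hasFDerivAt.comp_hasDerivAt_of_eq (1 : ℝ) hray (one_smul ℝ x).symm).unique h

theorem fderiv_penalty_self {n m k : ℕ} (D : Matrix (Fin n) (Fin n) ℝ)
    (A : Fin m → Matrix (Fin n) (Fin n) ℝ) (b : Fin m → ℝ) (μ : ℝ)
    (U : Matrix (Fin n) (Fin k) ℝ) :
    fderiv ℝ (fun W : Matrix (Fin n) (Fin k) ℝ =>
        mip D (W * Wᵀ) + μ * ∑ i, (mip (A i) (W * Wᵀ) - b i) ^ 2) U U =
      2 * mip D (U * Uᵀ) +
        4 * μ * ∑ i, (mip (A i) (U * Uᵀ) - b i) * mip (A i) (U * Uᵀ) := by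
  have hdiff := differentiable_mip_mul_transpose_self (n := n) k
  refine fderiv_apply_self (by fun_prop) ?_
  have hsq : HasDerivAt (fun t : ℝ => t ^ 2) 2 1 := by simpa using hasDerivAt_pow 2 (1 : ℝ)
  have hray (B : Matrix (Fin n) (Fin n) ℝ) (t : ℝ) :
      mip B ((t • U) * (t • U)ᵀ) = t ^ 2 * mip B (U * Uᵀ) := by
    rw [Matrix.transpose_smul, Matrix.smul_mul, Matrix.mul_smul, smul_smul, mip_smul_right, sq]
  simp only [hray]
  refine ((hsq.mul_const (mip D (U * Uᵀ))).fun_add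
    ((HasDerivAt.fun_sum (u := Finset.univ) fun i _ =>
      ((hsq.mul_const (mip (A i) (U * Uᵀ))).sub_const (b i)).fun_pow 2).const_mul μ)).congr_deriv ?_
  simp only [Finset.mul_sum]
  congr 1
  refine Finset.sum_congr rfl fun i _ => ?_
  norm_num
  ring

theorem sq_le_max_of_mul_sq_le {lam ε c x : ℝ} (hlam : 0 < lam) (hx : 0 ≤ x)
    (h : lam * x ^ 2 ≤ ε * x + c) : x ^ 2 ≤ max ((2 * ε / lam) ^ 2) (2 * c / lam) := by
  by_contra! hlt
  obtain ⟨hε_lt, hc_lt⟩ := max_lt_iff.1 hlt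
  rw [div_lt_iff₀ hlam] at hc_lt
  have hx_gt : 2 * ε / lam < x := lt_of_pow_lt_pow_left₀ 2 hx hε_lt
  rw [div_lt_iff₀ hlam] at hx_gt
  nlinarith [mul_le_mul_of_nonneg_right hx_gt.le hx]

/-- If the cost matrix satisfies `D ⪰ (λ/2)I`, then every `ε`-FOSP `U`
of `L(U) = ⟨D, UUᵀ⟩ + μ‖𝒜(UUᵀ) − b‖₂²` satisfies
`‖U‖_F² ≤ max{(2ε/λ)², (2μ/λ)‖b‖₂²}` and consequently
`‖r(U)‖₂ ≤ ‖𝒜‖·max{(2ε/λ)², (2μ/λ)‖b‖₂²} + ‖b‖₂`. -/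
theorem fosp_bounded_posdef_cost {n m k : ℕ}
    (D : Matrix (Fin n) (Fin n) ℝ) (hD : D.IsSymm) (lam : ℝ) (hlam : 0 < lam)
    (hDpsd : (D - (lam / 2) • (1 : Matrix (Fin n) (Fin n) ℝ)).PosSemidef)
    (A : Fin m → Matrix (Fin n) (Fin n) ℝ) (hA : ∀ i, (A i).IsSymm)
    (b : Fin m → ℝ) (μ ε : ℝ) (hμ : 0 < μ) (hε : 0 < ε)
    (U : Matrix (Fin n) (Fin k) ℝ)
    (hgrad : ∃ g : Matrix (Fin n) (Fin k) ℝ,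
      (∀ V, fderiv ℝ (fun W : Matrix (Fin n) (Fin k) ℝ =>
        mip D (W * Wᵀ) + μ * ∑ i, (mip (A i) (W * Wᵀ) - b i) ^ 2) U V = mipr g V) ∧
      fnorm g ≤ ε) :
    fnorm U ^ 2 ≤ max ((2 * ε / lam) ^ 2) (2 * μ / lam * vnorm b ^ 2) ∧
    vnorm (fun i => mip (A i) (U * Uᵀ) - b i) ≤
      opA A * max ((2 * ε / lam) ^ 2) (2 * μ / lam * vnorm b ^ 2) + vnorm b := by
  obtain ⟨g, hg, hgε⟩ := hgrad
  have hU : lam * fnorm U ^ 2 ≤ ε * fnorm U + μ * vnorm b ^ 2 := by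
    have hpair := (hg U).symm.trans (fderiv_penalty_self D A b μ U)
    have hcs : mipr g U ≤ ε * fnorm U :=
      (mipr_le_fnorm_mul_fnorm g U).trans (by gcongr; exact fnorm_nonneg U)
    have hcost := mul_fnorm_sq_le_mip hDpsd U
    have hres : -vnorm b ^ 2 ≤
        4 * ∑ i, (mip (A i) (U * Uᵀ) - b i) * mip (A i) (U * Uᵀ) := by
      rw [vnorm_sq, Finset.mul_sum, ← Finset.sum_neg_distrib]
      refine Finset.sum_le_sum fun i _ => ?_
      nlinarith [sq_nonneg (2 * mip (A i) (U * Uᵀ) - b i)]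
    nlinarith [mul_le_mul_of_nonneg_left hres hμ.le]
  have hbound : fnorm U ^ 2 ≤ max ((2 * ε / lam) ^ 2) (2 * μ / lam * vnorm b ^ 2) := by
    convert sq_le_max_of_mul_sq_le hlam (fnorm_nonneg U) hU using 2
    ring
  refine ⟨hbound, (vnorm_sub_le _ b).trans ?_⟩
  gcongr
  have hsymm : (U * Uᵀ).IsSymm := by simp [Matrix.IsSymm]
  exact (vnorm_mip_le_opA_mul_fnorm A hsymm).trans <|
    mul_le_mul_of_nonneg_left ((fnorm_mul_transpose_self_le U).trans hbound) (opA_nonneg A)
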